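/- Let α₁,...,αₙ form a multiplicative subgroup of F_q^*. Then the dual code of the twisted Reed–Solomon code C^{n,k}(α, t, h, η) is, up to nonzero column multipliers, equal to the twisted Reed–Solomon code C^{n,n−k}(α, k−h, n−k−t, −η); that is, the twist vector of the dual is k−h, the hook vector is n−k−t, and the coefficients are −η. -/

import Mathlib

open Polynomial

noncomputable def evalVec {F : Type*} [Field F] {n : ℕ} (α : Fin n → F) :
    F[X] →ₗ[F] (Fin n → F) :=
  LinearMap.pi fun i => Polynomial.leval (α i)

/-- The set of (t,h,η)-twisted polynomials: all `∑_{i<k} f_i Xⁱ + ∑_j η_j f_{h_j} X^{k-1+t_j}`. -/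
noncomputable def twistedSet {F : Type*} [Field F] (k ℓ : ℕ) (t h : Fin ℓ → ℕ)
    (η : Fin ℓ → F) : Set F[X] :=
  { g | ∃ f : ℕ → F,
      g = (∑ i ∈ Finset.range k, Polynomial.C (f i) * X ^ i)
        + ∑ j : Fin ℓ, Polynomial.C (η j * f (h j)) * X ^ (k - 1 + t j) }

/-- The twisted Reed–Solomon code: evaluation of the twisted polynomials at `α`. -/
noncomputable def twistedCode {F : Type*} [Field F] (n k ℓ : ℕ) (α : Fin n → F)
    (t h : Fin ℓ → ℕ) (η : Fin ℓ → F) : Submodule F (Fin n → F) :=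
  Submodule.span F (evalVec α '' twistedSet k ℓ t h η)

open Finset in
lemma sum_range_mul_pow_eq_ite {F : Type*} [Field F] {n : ℕ} {α : Fin n → F}
    (hα : Function.Injective α) (hroot : ∀ i, α i ^ n = 1) (i l : Fin n) :
    ∑ m ∈ range n, α i ^ m * α l ^ (n - m) = if i = l then (n : F) else 0 := by
  have hl : α l ≠ 0 := fun h0 => by
    have := hroot l
    rw [h0, zero_pow (Nat.ne_of_gt i.pos)] at this
    exact zero_ne_one this
  have hterm : ∀ m ∈ range n, α i ^ m * α l ^ (n - m) = (α i / α l) ^ m := by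
    intro m hm
    rw [pow_sub₀ _ hl (mem_range.1 hm).le, hroot, div_pow, one_mul, div_eq_mul_inv]
  rw [sum_congr rfl hterm]
  split_ifs with h
  · subst h
    simp [div_self hl]
  · have h1 : α i / α l ≠ 1 := fun h1 => h (hα ((div_eq_one_iff_eq hl).1 h1))
    rw [geom_sum_eq h1, div_pow, hroot, hroot]
    simp

lemma sum_pow_mul_pow_eq_ite {F : Type*} [Field F] {n : ℕ} {α : Fin n → F}
    (hα : Function.Injective α) (hroot : ∀ i, α i ^ n = 1) (hchar : (n : F) ≠ 0)
    {a b : ℕ} (ha : a < n) (hb : b < n) :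
    ∑ i, α i / (n : F) * α i ^ b * α i ^ a = if a + b = n - 1 then 1 else 0 := by
  let V : Matrix (Fin n) (Fin n) F := fun i m => α i ^ (m : ℕ)
  let W : Matrix (Fin n) (Fin n) F := fun m l => α l ^ (n - (m : ℕ)) / n
  have hVW : V * W = 1 := by
    ext i l
    rw [Matrix.mul_apply, Matrix.one_apply]
    have := sum_range_mul_pow_eq_ite hα hroot i l
    rw [Finset.sum_range] at this
    simp only [V, W, ← mul_div_assoc]
    rw [← Finset.sum_div, this]
    split_ifs <;> simp [hchar]
  have hWV : W * V = 1 := mul_eq_one_comm.1 hVW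
  have h := congrFun (congrFun hWV ⟨n - 1 - b, by omega⟩) ⟨a, ha⟩
  rw [Matrix.mul_apply, Matrix.one_apply] at h
  have hiff : ((⟨n - 1 - b, by omega⟩ : Fin n) = ⟨a, ha⟩) ↔ a + b = n - 1 := by
    rw [Fin.mk.injEq]
    omega
  simp only [hiff, V, W] at h
  rw [← h]
  refine Finset.sum_congr rfl fun i _ => ?_
  rw [show n - (n - 1 - b) = b + 1 by omega]
  ring

/-- Fourier inversion on the `n`-th roots of unity. -/
lemma eq_sum_range_mul_pow {F : Type*} [Field F] {n : ℕ} {α : Fin n → F}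
    (hα : Function.Injective α) (hroot : ∀ i, α i ^ n = 1) (hchar : (n : F) ≠ 0)
    (x : Fin n → F) (i : Fin n) :
    x i = α i / n * ∑ m ∈ Finset.range n, (∑ l, x l * α l ^ m) * α i ^ (n - 1 - m) := by
  have h : ∑ l, x l * ∑ m ∈ Finset.range n, α l ^ m * α i ^ (n - m) = x i * n := by
    simp [sum_range_mul_pow_eq_ite hα hroot]
  rw [eq_comm, div_mul_eq_mul_div, div_eq_iff hchar, ← h]
  simp only [Finset.mul_sum, Finset.sum_mul]
  rw [Finset.sum_comm]
  refine Finset.sum_congr rfl fun l _ => Finset.sum_congr rfl fun m hm => ?_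
  rw [show n - m = n - 1 - m + 1 by have := Finset.mem_range.1 hm; omega]
  ring

/-- The codeword of the twisted polynomial with coefficients `f`. -/
def twistedWord {F : Type*} [Field F] {n : ℕ} (k ℓ : ℕ) (α : Fin n → F)
    (t h : Fin ℓ → ℕ) (η : Fin ℓ → F) (f : ℕ → F) : Fin n → F := fun i =>
  ∑ a ∈ Finset.range k, f a * α i ^ a + ∑ j, η j * f (h j) * α i ^ (k - 1 + t j)

lemma twistedCode_eq_span {F : Type*} [Field F] (n k ℓ : ℕ) (α : Fin n → F)
    (t h : Fin ℓ → ℕ) (η : Fin ℓ → F) :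
    twistedCode n k ℓ α t h η =
      Submodule.span F (Set.range (twistedWord k ℓ α t h η)) := by
  unfold twistedCode
  congr 1
  have heval (f : ℕ → F) :
      evalVec α ((∑ i ∈ Finset.range k, C (f i) * X ^ i)
        + ∑ j : Fin ℓ, C (η j * f (h j)) * X ^ (k - 1 + t j)) = twistedWord k ℓ α t h η f := by
    ext i
    simp [evalVec, twistedWord, leval, eval_finsetSum]
  ext c
  constructor
  · rintro ⟨_, ⟨f, rfl⟩, rfl⟩
    exact ⟨f, (heval f).symm⟩
  · rintro ⟨f, rfl⟩
    exact ⟨_, ⟨f, rfl⟩, heval f⟩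

lemma sum_mul_twistedWord {F : Type*} [Field F] {n : ℕ} (k ℓ : ℕ) (α : Fin n → F)
    (t h : Fin ℓ → ℕ) (η : Fin ℓ → F) (f : ℕ → F) (x : Fin n → F) :
    ∑ i, x i * twistedWord k ℓ α t h η f i =
      ∑ a ∈ Finset.range k, f a * ∑ i, x i * α i ^ a
        + ∑ j, η j * f (h j) * ∑ i, x i * α i ^ (k - 1 + t j) := by
  simp only [twistedWord, mul_add, Finset.sum_add_distrib, Finset.mul_sum]
  rw [Finset.sum_comm]
  congr 1
  · exact Finset.sum_congr rfl fun _ _ => Finset.sum_congr rfl fun _ _ => by ring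
  · rw [Finset.sum_comm]
    exact Finset.sum_congr rfl fun _ _ => Finset.sum_congr rfl fun _ _ => by ring

lemma sum_dual_twistedWord_mul_pow {F : Type*} [Field F] {n k ℓ : ℕ} {α : Fin n → F}
    (hα : Function.Injective α) (hroot : ∀ i, α i ^ n = 1) (hchar : (n : F) ≠ 0)
    (hkn : k < n) (t h : Fin ℓ → ℕ) (η : Fin ℓ → F) (hh : ∀ j, h j < k) (f : ℕ → F)
    {a : ℕ} (ha : a < n) :
    ∑ i, (α i / (n : F) * twistedWord (n - k) ℓ α (fun j => k - h j) (fun j => n - k - t j)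
        (fun j => -η j) f i) * α i ^ a =
      (if k ≤ a then f (n - 1 - a) else 0)
        - ∑ j, if a = h j then η j * f (n - k - t j) else 0 := by
  have hcomm : ∀ i, (α i / (n : F) * twistedWord (n - k) ℓ α (fun j => k - h j)
        (fun j => n - k - t j) (fun j => -η j) f i) * α i ^ a =
      (α i / (n : F) * α i ^ a) * twistedWord (n - k) ℓ α (fun j => k - h j)
        (fun j => n - k - t j) (fun j => -η j) f i := fun i => by ring
  simp only [hcomm, sum_mul_twistedWord]
  rw [sub_eq_add_neg, ← Finset.sum_neg_distrib]
  congr 1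
  · have hterm : ∀ b ∈ Finset.range (n - k),
        f b * ∑ i, α i / (n : F) * α i ^ a * α i ^ b = if b = n - 1 - a then f b else 0 := by
      intro b hb
      have hb := Finset.mem_range.1 hb
      rw [sum_pow_mul_pow_eq_ite hα hroot hchar (by omega) ha, mul_ite, mul_one, mul_zero]
      exact if_congr (by omega) rfl rfl
    rw [Finset.sum_congr rfl hterm, Finset.sum_ite_eq']
    exact if_congr (by rw [Finset.mem_range]; omega) rfl rfl
  · refine Finset.sum_congr rfl fun j _ => ?_
    have hj := hh j
    rw [sum_pow_mul_pow_eq_ite hα hroot hchar (by omega) ha,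
      if_congr (show n - k - 1 + (k - h j) + a = n - 1 ↔ a = h j by omega) rfl rfl]
    split_ifs <;> ring

lemma sum_dual_twistedWord_mul_twistedWord {F : Type*} [Field F] {n k ℓ : ℕ} {α : Fin n → F}
    (hα : Function.Injective α) (hroot : ∀ i, α i ^ n = 1) (hchar : (n : F) ≠ 0)
    (hkn : k < n) (t h : Fin ℓ → ℕ) (η : Fin ℓ → F)
    (ht1 : ∀ j, 1 ≤ t j) (ht2 : ∀ j, t j ≤ n - k) (hh : ∀ j, h j < k) (f g : ℕ → F) :
    ∑ i, (α i / (n : F) * twistedWord (n - k) ℓ α (fun j => k - h j) (fun j => n - k - t j)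
        (fun j => -η j) g i) * twistedWord k ℓ α t h η f i = 0 := by
  rw [sum_mul_twistedWord]
  have hlow : ∀ a ∈ Finset.range k,
      f a * ∑ i, (α i / (n : F) * twistedWord (n - k) ℓ α (fun j => k - h j)
        (fun j => n - k - t j) (fun j => -η j) g i) * α i ^ a =
      -∑ j, if a = h j then η j * f (h j) * g (n - k - t j) else 0 := by
    intro a ha
    have ha := Finset.mem_range.1 ha
    rw [sum_dual_twistedWord_mul_pow hα hroot hchar hkn t h η hh g (by omega),
      if_neg (by omega), zero_sub, mul_neg, Finset.mul_sum]
    congr 1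
    refine Finset.sum_congr rfl fun j _ => ?_
    split_ifs with haj
    · rw [haj]
      ring
    · ring
  have hhigh : ∀ j, ∑ i, (α i / (n : F) * twistedWord (n - k) ℓ α (fun j => k - h j)
        (fun j => n - k - t j) (fun j => -η j) g i) * α i ^ (k - 1 + t j) =
      g (n - k - t j) := by
    intro j
    have h1 := ht1 j
    have h2 := ht2 j
    have hj := hh j
    rw [sum_dual_twistedWord_mul_pow hα hroot hchar hkn t h η hh g (by omega),
      if_pos (by omega), Finset.sum_eq_zero, sub_zero]
    · congr 1
      omega
    · intro j' _
      have := hh j'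
      exact if_neg (by omega)
  rw [Finset.sum_congr rfl hlow, Finset.sum_neg_distrib, Finset.sum_comm]
  simp only [hhigh, Finset.sum_ite_eq', Finset.mem_range, hh, if_true, neg_add_cancel]

lemma exists_dual_twistedWord {F : Type*} [Field F] {n k ℓ : ℕ} {α : Fin n → F}
    (hα : Function.Injective α) (hroot : ∀ i, α i ^ n = 1) (hchar : (n : F) ≠ 0)
    (hk : 0 < k) (hkn : k < n) (t h : Fin ℓ → ℕ) (η : Fin ℓ → F)
    (ht1 : ∀ j, 1 ≤ t j) (ht2 : ∀ j, t j ≤ n - k)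
    (hh : ∀ j, h j < k) (x : Fin n → F)
    (hx : ∀ f, ∑ i, x i * twistedWord k ℓ α t h η f i = 0) :
    ∃ g, ∀ i, x i = α i / (n : F) * twistedWord (n - k) ℓ α (fun j => k - h j)
      (fun j => n - k - t j) (fun j => -η j) g i := by
  set p : ℕ → F := fun m => ∑ l, x l * α l ^ m with hp
  have hlow : ∀ a < k, p a = ∑ j, if h j = a then -η j * p (k - 1 + t j) else 0 := by
    intro a ha
    have := hx (Pi.single a 1)
    rw [sum_mul_twistedWord] at this
    simp only [Pi.single_apply, ite_mul, one_mul, zero_mul, Finset.sum_ite_eq',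
      Finset.mem_range, ha, if_true, mul_ite, mul_one, mul_zero] at this
    change ∑ l, x l * α l ^ a = _
    rw [eq_neg_of_add_eq_zero_left this, ← Finset.sum_neg_distrib]
    refine Finset.sum_congr rfl fun j _ => ?_
    split_ifs <;> simp [hp]
  refine ⟨fun s => p (n - 1 - s), fun i => ?_⟩
  rw [eq_sum_range_mul_pow hα hroot hchar x i]
  congr 1
  change ∑ m ∈ Finset.range n, p m * α i ^ (n - 1 - m) = _
  have hsplit (φ : ℕ → F) : ∑ m ∈ Finset.range n, φ m =
      ∑ m ∈ Finset.range (n - k), φ m + ∑ m ∈ Finset.range k, φ (n - k + m) := by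
    rw [← Finset.sum_range_add, Nat.sub_add_cancel hkn.le]
  rw [← Finset.sum_range_reflect, hsplit, twistedWord]
  congr 1
  · refine Finset.sum_congr rfl fun s hs => ?_
    have := Finset.mem_range.1 hs
    rw [show n - 1 - (n - 1 - s) = s by omega]
  · rw [← Finset.sum_range_reflect]
    have hterm : ∀ a ∈ Finset.range k,
        p (n - 1 - (n - k + (k - 1 - a))) * α i ^ (n - 1 - (n - 1 - (n - k + (k - 1 - a)))) =
        ∑ j, if h j = a then -η j * p (k - 1 + t j) * α i ^ (n - 1 - h j) else 0 := by
      intro a ha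
      have ha := Finset.mem_range.1 ha
      rw [show n - 1 - (n - k + (k - 1 - a)) = a by omega, hlow a ha, Finset.sum_mul]
      refine Finset.sum_congr rfl fun j _ => ?_
      split_ifs with hj
      · rw [hj]
      · ring
    rw [Finset.sum_congr rfl hterm, Finset.sum_comm]
    simp only [Finset.sum_ite_eq, Finset.mem_range, hh, if_true]
    refine Finset.sum_congr rfl fun j _ => ?_
    have h1 := ht1 j
    have h2 := ht2 j
    have hj := hh j
    rw [show n - 1 - (n - k - t j) = k - 1 + t j by omega,
      show n - k - 1 + (k - h j) = n - 1 - h j by omega]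

/-- If the evaluation points form a multiplicative subgroup of `F_q^*` of order `n`,
then the dual of `C^{n,k}(α,t,h,η)` equals, up to the column multipliers `αᵢ/n`,
the twisted Reed–Solomon code `C^{n,n-k}(α, k-h, n-k-t, -η)`. -/
theorem twistedCode_dual {F : Type*} [Field F] [Fintype F] {n k ℓ : ℕ}
    (hk : 0 < k) (hkn : k < n)
    (α : Fin n → F) (hα : Function.Injective α)
    (hroot : ∀ i, α i ^ n = 1) (hchar : (n : F) ≠ 0)
    (t h : Fin ℓ → ℕ) (η : Fin ℓ → F)
    (ht1 : ∀ j, 1 ≤ t j) (ht2 : ∀ j, t j ≤ n - k) (htinj : Function.Injective t)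
    (hh : ∀ j, h j < k) (hhinj : Function.Injective h)
    (hη : ∀ j, η j ≠ 0) :
    { x : Fin n → F | ∀ c ∈ twistedCode n k ℓ α t h η, ∑ i, x i * c i = 0 }
      = (fun c : Fin n → F => fun i => (α i / (n : F)) * c i) ''
          ↑(twistedCode n (n - k) ℓ α (fun j => k - h j) (fun j => n - k - t j)
              (fun j => -η j)) := by
  ext x
  rw [twistedCode_eq_span, twistedCode_eq_span]
  constructor
  · intro hx
    obtain ⟨g, hg⟩ := exists_dual_twistedWord hα hroot hchar hk hkn t h η ht1 ht2 hh x
      fun f => hx _ (Submodule.subset_span ⟨f, rfl⟩)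
    exact ⟨_, Submodule.subset_span ⟨g, rfl⟩, funext fun i => (hg i).symm⟩
  · rintro ⟨d, hd, rfl⟩ c hc
    induction hc using Submodule.span_induction with
    | mem c hc =>
      obtain ⟨f, rfl⟩ := hc
      induction hd using Submodule.span_induction with
      | mem d hd =>
        obtain ⟨g, rfl⟩ := hd
        exact sum_dual_twistedWord_mul_twistedWord hα hroot hchar hkn t h η ht1 ht2 hh f g
      | zero => simp
      | add d e _ _ hd he =>
        simp only [Pi.add_apply, mul_add, add_mul, Finset.sum_add_distrib] at hd he ⊢
        rw [hd, he, add_zero]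
      | smul r d _ hd =>
        simp only [Pi.smul_apply, smul_eq_mul, mul_left_comm _ r, mul_assoc r,
          ← Finset.mul_sum] at hd ⊢
        rw [hd, mul_zero]
    | zero => simp
    | add c e _ _ hc he =>
      simp only [Pi.add_apply, mul_add, Finset.sum_add_distrib] at hc he ⊢
      rw [hc, he, add_zero]
    | smul r c _ hc =>
      simp only [Pi.smul_apply, smul_eq_mul, mul_left_comm _ r, ← Finset.mul_sum] at hc ⊢
      rw [hc, mul_zero]
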